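/- arXiv:2505.08129 — 4 statements merged into one kernel-verified Lean document; each statement's English description precedes it below -/
import Mathlib

section
/- Let n be a positive integer, let A be a real symmetric positive semidefinite n×n matrix and let R be a real symmetric positive definite n×n matrix. Then A+R is invertible and the spectral radius of the swapped regularization factor F(R) = A(A+R)⁻¹ satisfies ρ(F(R)) < 1. -/
/-- If `A` is positive semidefinite and `R` is positive definite, every real eigenvalue of
`A * (A + R)⁻¹` has absolute value less than one. -/
theorem norm_lt_one_of_mem_spectrum_mul_inv_add {m : Type*} [Fintype m] [DecidableEq m]
    {A R : Matrix m m ℝ} (hA : A.PosSemidef) (hR : R.PosDef) {k : ℝ}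
    (hk : k ∈ spectrum ℝ (A * (A + R)⁻¹)) : ‖k‖ < 1 := by
  have hU : IsUnit (A + R) := (Matrix.PosDef.posSemidef_add hA hR).isUnit
  have hdet : IsUnit (A + R).det := (Matrix.isUnit_iff_isUnit_det _).1 hU
  by_contra! h
  refine hk ?_
  have factor : algebraMap ℝ (Matrix m m ℝ) k - A * (A + R)⁻¹
      = ((k - 1) • A + k • R) * (A + R)⁻¹ := by
    have : (k - 1) • A + k • R = k • (A + R) - A := by module
    rw [this, sub_mul, smul_mul_assoc, Matrix.mul_nonsing_inv _ hdet,
      Algebra.algebraMap_eq_smul_one]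
  rw [spectrum.mem_resolventSet_iff, factor]
  refine IsUnit.mul ?_ (Matrix.isUnit_nonsing_inv_iff.2 hU)
  rw [Real.norm_eq_abs, le_abs] at h
  rcases h with h | h
  · exact (Matrix.PosDef.posSemidef_add (hA.smul (by linarith)) (hR.smul (by linarith))).isUnit
  · have hneg : (k - 1) • A + k • R = -((1 - k) • A + (-k) • R) := by module
    rw [hneg, IsUnit.neg_iff]
    exact (Matrix.PosDef.posSemidef_add (hA.smul (by linarith)) (hR.smul (by linarith))).isUnit

/-- For `A` real symmetric positive semidefinite and `R` real symmetric positive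
definite, `A + R` is invertible and the spectral radius of the swapped regularization factor
`F(R) = A (A + R)⁻¹` satisfies `ρ(F(R)) < 1`. -/
theorem spectralRadius_swapped_regularization_factor_lt_one
    (n : ℕ) (hn : 0 < n) (A R : Matrix (Fin n) (Fin n) ℝ)
    (hA : A.PosSemidef) (hR : R.PosDef) :
    IsUnit (A + R) ∧ spectralRadius ℝ (A * (A + R)⁻¹) < 1 := by
  refine ⟨(Matrix.PosDef.posSemidef_add hA hR).isUnit, ?_⟩
  rcases (spectrum ℝ (A * (A + R)⁻¹)).eq_empty_or_nonempty with he | hne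
  · simp [spectralRadius, he]
  · rw [spectralRadius, ← sSup_image,
      ((A * (A + R)⁻¹).finite_real_spectrum.image _).csSup_lt_iff (hne.image _)]
    rintro _ ⟨k, hk, rfl⟩
    have hlt := norm_lt_one_of_mem_spectrum_mul_inv_add hA hR hk
    exact ENNReal.coe_lt_one_iff.2 hlt
end

section
/- Let A be a real symmetric positive definite n×n matrix, let R be a real symmetric positive semidefinite n×n matrix, and set F = R(A+R)⁻¹. Then for every natural number c, the approximation residual satisfies the exact identity A⁻¹ − (A+R)⁻¹ · ∑_{i=0}^{c} Fⁱ = A⁻¹ · F^{c+1}. -/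
/-- The residual identity, requiring only that `A` and `A + R` be invertible. -/
theorem Matrix.inv_sub_inv_add_mul_geom_sum {ι 𝕜 : Type*} [Fintype ι] [DecidableEq ι]
    [CommRing 𝕜] (A R : Matrix ι ι 𝕜) (hA : IsUnit A.det) (hAR : IsUnit (A + R).det) (m : ℕ) :
    A⁻¹ - (A + R)⁻¹ * (∑ i ∈ Finset.range m, (R * (A + R)⁻¹) ^ i) =
      A⁻¹ * (R * (A + R)⁻¹) ^ m := by
  have h_one_sub : 1 - R * (A + R)⁻¹ = A * (A + R)⁻¹ := by
    rw [sub_eq_iff_eq_add, ← add_mul, Matrix.mul_nonsing_inv _ hAR]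
  have h_inv : (A + R)⁻¹ = A⁻¹ * (1 - R * (A + R)⁻¹) := by
    rw [h_one_sub, Matrix.nonsing_inv_mul_cancel_left _ _ hA]
  have h_sum : (A + R)⁻¹ * (∑ i ∈ Finset.range m, (R * (A + R)⁻¹) ^ i) =
      A⁻¹ * (1 - (R * (A + R)⁻¹) ^ m) := by
    rw [← mul_neg_geom_sum, ← mul_assoc, ← h_inv]
  rw [h_sum, mul_sub, mul_one, sub_sub_cancel]

/-- For `A` real symmetric positive definite, `R` real symmetric positive
semidefinite, and `F = R (A + R)⁻¹`, for every natural number `c`,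
`A⁻¹ − (A + R)⁻¹ ⬝ ∑_{i=0}^{c} Fⁱ = A⁻¹ ⬝ F^{c+1}`. -/
theorem hr_approximation_residual_eq
    (n : ℕ) (A R : Matrix (Fin n) (Fin n) ℝ)
    (hA : A.PosDef) (hR : R.PosSemidef) :
    ∀ c : ℕ,
      A⁻¹ - (A + R)⁻¹ * (∑ i ∈ Finset.range (c + 1), (R * (A + R)⁻¹) ^ i) =
        A⁻¹ * (R * (A + R)⁻¹) ^ (c + 1) :=
  fun c => Matrix.inv_sub_inv_add_mul_geom_sum A R hA.det_pos.ne'.isUnit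
    (hA.add_posSemidef hR).det_pos.ne'.isUnit (c + 1)
end

section
/- Let A be a real symmetric positive definite n×n matrix, let R₁ and R₂ be real symmetric positive semidefinite n×n matrices such that A, R₁, R₂ pairwise commute, and let a ∈ [0,1]. Then, in the Loewner partial order, (aR₁+(1−a)R₂)(A + aR₁+(1−a)R₂)⁻¹ ⪯ aR₁(A+aR₁)⁻¹ + (1−a)R₂(A+(1−a)R₂)⁻¹. -/
namespace Matrix

open scoped MatrixOrder in
theorem PosSemidef.mul_of_commute {m : Type*} [Fintype m] [DecidableEq m]
    {P Q : Matrix m m ℝ} (hP : P.PosSemidef) (hQ : Q.PosSemidef) (h : Commute P Q) :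
    (P * Q).PosSemidef :=
  nonneg_iff_posSemidef.1 (h.mul_nonneg hP.nonneg hQ.nonneg)

theorem commute_nonsing_inv_right {m K : Type*} [Fintype m] [DecidableEq m] [CommRing K]
    {X Y : Matrix m m K} (h : Commute X Y) : Commute X Y⁻¹ := by
  rw [← Matrix.zpow_neg_one]
  exact Matrix.Commute.zpow_right h (-1)

/-- The factor `R ↦ R (A + R)⁻¹` is subadditive on commuting positive semidefinite matrices. -/
theorem PosDef.mul_inv_add_subadditive {m : Type*} [Fintype m] [DecidableEq m]
    {A S T : Matrix m m ℝ} (hA : A.PosDef) (hS : S.PosSemidef) (hT : T.PosSemidef)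
    (hAS : Commute A S) (hAT : Commute A T) (hST : Commute S T) :
    (S * (A + S)⁻¹ + T * (A + T)⁻¹ - (S + T) * (A + S + T)⁻¹).PosSemidef := by
  have hX := hA.add_posSemidef hS
  have hY := hA.add_posSemidef hT
  have hZ := hX.add_posSemidef hT
  have hSX : Commute S (A + S)⁻¹ := commute_nonsing_inv_right (hAS.symm.add_right (.refl S))
  have hTX : Commute T (A + S)⁻¹ := commute_nonsing_inv_right (hAT.symm.add_right hST.symm)
  have hSY : Commute S (A + T)⁻¹ := commute_nonsing_inv_right (hAS.symm.add_right hST)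
  have hTY : Commute T (A + T)⁻¹ := commute_nonsing_inv_right (hAT.symm.add_right (.refl T))
  have hSZ : Commute S (A + S + T)⁻¹ :=
    commute_nonsing_inv_right ((hAS.symm.add_right (.refl S)).add_right hST)
  have hTZ : Commute T (A + S + T)⁻¹ :=
    commute_nonsing_inv_right ((hAT.symm.add_right hST.symm).add_right (.refl T))
  have hAZ : Commute A (A + S + T)⁻¹ :=
    commute_nonsing_inv_right (((Commute.refl A).add_right hAS).add_right hAT)
  have hXZ : Commute (A + S)⁻¹ (A + S + T)⁻¹ :=
    (commute_nonsing_inv_right (hAZ.add_left hSZ).symm).symm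
  have hYZ : Commute (A + T)⁻¹ (A + S + T)⁻¹ :=
    (commute_nonsing_inv_right (hAZ.add_left hTZ).symm).symm
  have diff_inv {X U Z : Matrix m m ℝ} (hX : IsUnit X) (hZ : IsUnit Z) (h : Z = X + U) :
      X⁻¹ - Z⁻¹ = X⁻¹ * U * Z⁻¹ := by
    rw [Matrix.inv_sub_inv (iff_of_true hX hZ), h, add_sub_cancel_left]
  have key : S * (A + S)⁻¹ + T * (A + T)⁻¹ - (S + T) * (A + S + T)⁻¹ =
      S * (A + S)⁻¹ * T * (A + S + T)⁻¹ + T * (A + T)⁻¹ * S * (A + S + T)⁻¹ := by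
    calc
      _ = S * ((A + S)⁻¹ - (A + S + T)⁻¹) + T * ((A + T)⁻¹ - (A + S + T)⁻¹) := by noncomm_ring
      _ = _ := by
        rw [diff_inv hX.isUnit hZ.isUnit rfl,
          diff_inv hY.isUnit hZ.isUnit (add_right_comm A S T)]
        simp only [mul_assoc]
  rw [key]
  exact ((((hS.mul_of_commute hX.inv.posSemidef hSX).mul_of_commute hT
      (hST.mul_left hTX.symm)).mul_of_commute hZ.inv.posSemidef
      ((hSZ.mul_left hXZ).mul_left hTZ))).add
    (((hT.mul_of_commute hY.inv.posSemidef hTY).mul_of_commute hS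
      (hST.symm.mul_left hSY.symm)).mul_of_commute hZ.inv.posSemidef
      ((hTZ.mul_left hYZ).mul_left hSZ))

end Matrix

/-- Convexity-type inequality for the regularization factor in the Loewner order:
for `A` symmetric positive definite, `R₁, R₂` symmetric positive semidefinite, pairwise
commuting with `A`, and `a ∈ [0,1]`,
`(aR₁+(1−a)R₂)(A + aR₁+(1−a)R₂)⁻¹ ⪯ aR₁(A+aR₁)⁻¹ + (1−a)R₂(A+(1−a)R₂)⁻¹`,
where `M ⪯ N` means `N − M` is positive semidefinite. -/
theorem regularization_factor_convexity
    (n : ℕ) (A R₁ R₂ : Matrix (Fin n) (Fin n) ℝ)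
    (hA : A.PosDef) (hR₁ : R₁.PosSemidef) (hR₂ : R₂.PosSemidef)
    (hAR₁ : A * R₁ = R₁ * A) (hAR₂ : A * R₂ = R₂ * A) (hR₁R₂ : R₁ * R₂ = R₂ * R₁)
    (a : ℝ) (ha : a ∈ Set.Icc (0 : ℝ) 1) :
    (a • (R₁ * (A + a • R₁)⁻¹) + (1 - a) • (R₂ * (A + (1 - a) • R₂)⁻¹) -
        (a • R₁ + (1 - a) • R₂) * (A + a • R₁ + (1 - a) • R₂)⁻¹).PosSemidef := by
  have hAS : Commute A (a • R₁) := Commute.smul_right hAR₁ a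
  have hAT : Commute A ((1 - a) • R₂) := Commute.smul_right hAR₂ (1 - a)
  have hST : Commute (a • R₁) ((1 - a) • R₂) :=
    (Commute.smul_right hR₁R₂ (1 - a)).smul_left a
  simpa only [Matrix.smul_mul] using hA.mul_inv_add_subadditive (hR₁.smul ha.1)
    (hR₂.smul (sub_nonneg.2 ha.2)) hAS hAT hST
end

section
/- Let A be a real symmetric positive semidefinite n×n matrix and R a real symmetric positive definite n×n matrix, and set F = A(A+R)⁻¹. Then the sequence of approximate inverse mappings c ↦ (A+R)⁻¹ ∑_{i=0}^{c} Fⁱ converges to R⁻¹ as c → ∞; equivalently, the approximation residual A† − (A+R)⁻¹ ∑_{i=0}^{c} Fⁱ converges to A† − R⁻¹ as c → ∞, where A† denotes the Moore–Penrose pseudo-inverse of A. -/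
/-- `B` is the Moore–Penrose pseudo-inverse of the real square matrix `A`: the four Penrose
conditions. -/
def IsMoorePenroseInv {n : ℕ} (A B : Matrix (Fin n) (Fin n) ℝ) : Prop :=
  A * B * A = A ∧ B * A * B = B ∧ (A * B).transpose = A * B ∧ (B * A).transpose = B * A

open Filter Topology in
/-- The powers of a positive semidefinite real matrix `P` with `1 - P` positive definite tend to
zero. -/
theorem Matrix.PosSemidef.tendsto_pow_zero {m : Type*} [Fintype m] [DecidableEq m]
    {P : Matrix m m ℝ} (hP : P.PosSemidef) (hP' : (1 - P).PosDef) :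
    Tendsto (fun k : ℕ => P ^ k) atTop (𝓝 0) := by
  set U := hP.isHermitian.eigenvectorUnitary
  set d := hP.isHermitian.eigenvalues
  have hspec : P = Unitary.conjStarAlgAut ℝ _ U (Matrix.diagonal d) :=
    hP.isHermitian.spectral_theorem
  have hlt (i : m) : d i < 1 := by
    have hone : 1 - P = Unitary.conjStarAlgAut ℝ _ U (Matrix.diagonal fun i => 1 - d i) := by
      rw [← Matrix.diagonal_sub, map_sub, ← hspec, Matrix.diagonal_one, map_one]
    rw [hone, Unitary.conjStarAlgAut_apply,
      Matrix.IsUnit.posDef_star_right_conjugate_iff (Unitary.isUnit_coe),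
      Matrix.posDef_diagonal_iff] at hP'
    exact sub_pos.mp (hP' i)
  have hdiag : Tendsto (fun k : ℕ => Matrix.diagonal d ^ k) atTop (𝓝 0) := by
    have hd : Tendsto (fun k : ℕ => d ^ k) atTop (𝓝 0) :=
      tendsto_pi_nhds.mpr fun i =>
        tendsto_pow_atTop_nhds_zero_of_lt_one (hP.eigenvalues_nonneg i) (hlt i)
    simpa only [Matrix.diagonal_pow, Matrix.diagonal_zero', Function.comp_def, id] using
      (continuous_id.matrix_diagonal.tendsto (0 : m → ℝ)).comp hd
  have hconj := (hdiag.const_mul (U : Matrix m m ℝ)).mul_const (star (U : Matrix m m ℝ))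
  rw [mul_zero, zero_mul] at hconj
  refine hconj.congr fun k => ?_
  rw [hspec, ← map_pow, Unitary.conjStarAlgAut_apply]

open scoped MatrixOrder in
/-- A positive definite real matrix is of the form `star u * u` with `u` invertible. -/
theorem Matrix.PosDef.exists_units_star_mul_self {m : Type*} [Fintype m] [DecidableEq m]
    {M : Matrix m m ℝ} (hM : M.PosDef) : ∃ u : (Matrix m m ℝ)ˣ, M = star (u : Matrix m m ℝ) * u := by
  obtain ⟨B, hB⟩ := CStarAlgebra.nonneg_iff_eq_star_mul_self.mp hM.posSemidef.nonneg
  have hunit : IsUnit B := isUnit_of_mul_isUnit_right (hB ▸ hM.isUnit)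
  exact ⟨hunit.unit, hB⟩

open Filter Topology in
/-- For `A` positive semidefinite and `R` positive definite, the powers of `A * (A + R)⁻¹` tend
to zero. -/
theorem Matrix.PosSemidef.tendsto_mul_add_inv_pow_zero {m : Type*} [Fintype m] [DecidableEq m]
    {A R : Matrix m m ℝ} (hA : A.PosSemidef) (hR : R.PosDef) :
    Tendsto (fun k : ℕ => (A * (A + R)⁻¹) ^ k) atTop (𝓝 0) := by
  obtain ⟨u, hu⟩ := (hR.posSemidef_add hA).exists_units_star_mul_self
  set v : Matrix m m ℝ := ↑u⁻¹
  have hR' : R = star (u : Matrix m m ℝ) * u - A := eq_sub_of_add_eq' hu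
  have huv : (u : Matrix m m ℝ) * v = 1 := u.mul_inv
  have hvu : star v * star (u : Matrix m m ℝ) = 1 := by rw [← star_mul, huv, star_one]
  have hP : (star v * A * v).PosSemidef := hA.conjTranspose_mul_mul_same v
  have hP' : (1 - star v * A * v).PosDef := by
    have h : 1 - star v * A * v = star v * R * v := by
      rw [hR', mul_sub, sub_mul, ← mul_assoc, hvu, one_mul, huv]
    rw [h]
    exact (Matrix.IsUnit.posDef_star_left_conjugate_iff u⁻¹.isUnit).mpr hR
  have hconj (k : ℕ) :
      (A * (A + R)⁻¹) ^ k = star (u : Matrix m m ℝ) * (star v * A * v) ^ k * star v := by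
    have hinv : (A + R)⁻¹ = v * star v := by
      refine Matrix.inv_eq_right_inv ?_
      rw [hu, mul_assoc, ← mul_assoc _ v, huv, one_mul, ← star_mul]
      simp [v]
    have hF : A * (A + R)⁻¹ =
        ((star u : (Matrix m m ℝ)ˣ) : Matrix m m ℝ) * (star v * A * v) *
          (((star u)⁻¹ : (Matrix m m ℝ)ˣ) : Matrix m m ℝ) := by
      have huv' : star (u : Matrix m m ℝ) * star v = 1 := by
        rw [← star_mul]; simp [v]
      rw [hinv, ← star_inv, Units.coe_star, Units.coe_star]
      simp only [← mul_assoc, huv', one_mul, v]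
    rw [hF, Units.conj_pow, ← star_inv, Units.coe_star, Units.coe_star]
  simp only [hconj]
  simpa using ((hP.tendsto_pow_zero hP').const_mul (star (u : Matrix m m ℝ))).mul_const (star v)

/-- The truncated Neumann series of `R⁻¹ = (A + R)⁻¹ (1 - A (A + R)⁻¹)⁻¹`, with its remainder. -/
theorem Matrix.add_inv_mul_geom_sum {m : Type*} [Fintype m] [DecidableEq m]
    {K : Type*} [CommRing K] {A R : Matrix m m K} (hM : IsUnit (A + R)) (hR : IsUnit R) (k : ℕ) :
    (A + R)⁻¹ * ∑ i ∈ Finset.range k, (A * (A + R)⁻¹) ^ i =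
      R⁻¹ - (A + R)⁻¹ * (A * (A + R)⁻¹) ^ k * ((A + R) * R⁻¹) := by
  rw [Matrix.isUnit_iff_isUnit_det] at hM hR
  have hF : (1 - A * (A + R)⁻¹) * ((A + R) * R⁻¹) = 1 := by
    rw [sub_mul, one_mul, ← mul_assoc, mul_assoc A, Matrix.nonsing_inv_mul _ hM, mul_one,
      ← sub_mul, add_sub_cancel_left, Matrix.mul_nonsing_inv _ hR]
  calc (A + R)⁻¹ * ∑ i ∈ Finset.range k, (A * (A + R)⁻¹) ^ i
      = (A + R)⁻¹ * ((∑ i ∈ Finset.range k, (A * (A + R)⁻¹) ^ i) * (1 - A * (A + R)⁻¹)) *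
          ((A + R) * R⁻¹) := by
        rw [mul_assoc (A + R)⁻¹, mul_assoc (∑ i ∈ Finset.range k, _), hF, mul_one]
    _ = R⁻¹ - (A + R)⁻¹ * (A * (A + R)⁻¹) ^ k * ((A + R) * R⁻¹) := by
        rw [geom_sum_mul_neg, mul_sub, mul_one, sub_mul, ← mul_assoc (A + R)⁻¹ (A + R),
          Matrix.nonsing_inv_mul _ hM, one_mul]

/-- For `A` real symmetric positive semidefinite, `R` real symmetric positive
definite and `F = A (A + R)⁻¹`, the approximate inverse mappings
`(A + R)⁻¹ ∑_{i=0}^{c} Fⁱ` converge to `R⁻¹` as `c → ∞`; equivalently, the approximation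
residual `A† − (A + R)⁻¹ ∑_{i=0}^{c} Fⁱ` converges to `A† − R⁻¹`, where `A†` is the
Moore–Penrose pseudo-inverse of `A`. -/
theorem hr_approx_inverse_tendsto_inv_regularization
    (n : ℕ) (A R : Matrix (Fin n) (Fin n) ℝ)
    (hA : A.PosSemidef) (hR : R.PosDef) :
    Filter.Tendsto
      (fun c : ℕ =>
        (A + R)⁻¹ * ∑ i ∈ Finset.range (c + 1), (A * (A + R)⁻¹) ^ i)
      Filter.atTop (nhds R⁻¹) ∧
    ∀ Adag : Matrix (Fin n) (Fin n) ℝ, IsMoorePenroseInv A Adag →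
      Filter.Tendsto
        (fun c : ℕ =>
          Adag - (A + R)⁻¹ * ∑ i ∈ Finset.range (c + 1), (A * (A + R)⁻¹) ^ i)
        Filter.atTop (nhds (Adag - R⁻¹)) := by
  have key : Filter.Tendsto
      (fun c : ℕ => (A + R)⁻¹ * ∑ i ∈ Finset.range (c + 1), (A * (A + R)⁻¹) ^ i)
      Filter.atTop (nhds R⁻¹) := by
    simp only [Matrix.add_inv_mul_geom_sum (hR.posSemidef_add hA).isUnit hR.isUnit]
    have hpow := (hA.tendsto_mul_add_inv_pow_zero hR).comp (Filter.tendsto_add_atTop_nat 1)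
    simpa using ((hpow.const_mul (A + R)⁻¹).mul_const ((A + R) * R⁻¹)).const_sub R⁻¹
  exact ⟨key, fun Adag _ => key.const_sub Adag⟩
end
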